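/- Let (R,m) be a Noetherian local ring with infinite residue field, and let I be an ideal generated by a system of parameters of R. Then I has no proper reduction: if J ⊆ I is an ideal such that I is integral over J, then J = I. -/

import Mathlib

open IsLocalRing

/-- A system of parameters of a Noetherian local ring of dimension `d`: `d` elements of the
maximal ideal generating an ideal primary for the maximal ideal. -/
def IsSystemOfParameters (R : Type*) [CommRing R] [IsLocalRing R] {d : ℕ} (x : Fin d → R) :
    Prop :=
  ringKrullDim R = (d : WithBot ℕ∞) ∧ (∀ i, x i ∈ maximalIdeal R) ∧
    ∃ n : ℕ, (maximalIdeal R) ^ n ≤ Ideal.span (Set.range x)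

/-- `J` is a reduction of `I` if `J ⊆ I` and `J I^n = I^{n+1}` for some `n ≥ 0`;
equivalently, `I` is integral over `J`. -/
def IsIdealReduction {R : Type*} [CommRing R] (J I : Ideal R) : Prop :=
  J ≤ I ∧ ∃ n : ℕ, J * I ^ n = I ^ (n + 1)

open Submodule in
/-- Modulo the maximal ideal, a proper submodule of a finitely generated module over a local ring
is generated by fewer elements than the whole module. -/
theorem exists_finset_card_lt_spanFinrank_of_lt {R M : Type*} [CommRing R] [IsLocalRing R]
    [AddCommGroup M] [Module R M] {N P : Submodule R M} (hP : P.FG) (hNP : N < P) :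
    ∃ s : Finset M, (s : Set M) ⊆ N ∧ s.card < P.spanFinrank ∧
      N ≤ span R (s : Set M) ⊔ maximalIdeal R • P := by
  classical
  let : Field (R ⧸ maximalIdeal R) := Ideal.Quotient.field _
  have : Module.Finite R P := Module.Finite.iff_fg.mpr hP
  let V := P ⧸ (maximalIdeal R) • (⊤ : Submodule R P)
  have : Module.Finite (R ⧸ maximalIdeal R) V :=
    Module.Finite.of_restrictScalars_finite R _ _
  let q : P →ₗ[R] V := mkQ _
  let N' : Submodule R P := N.comap P.subtype
  let W : Submodule (R ⧸ maximalIdeal R) V := span _ (q '' N')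
  have hW : W.restrictScalars R = N'.map q := by
    rw [restrictScalars_span R _ Ideal.Quotient.mk_surjective, ← map_span, span_eq]
  have hW_ne : W ≠ ⊤ := by
    intro h
    rw [h, restrictScalars_top, eq_comm, IsLocalRing.map_mkQ_eq_top] at hW
    exact hNP.not_ge (comap_subtype_eq_top.mp hW)
  obtain ⟨t, ht, ht_card, ht_span, -⟩ :=
    exists_finset_span_eq_linearIndepOn (R ⧸ maximalIdeal R) (q '' N')
  obtain ⟨u, hu, hinj, rfl⟩ := Finset.exists_subset_injOn_image_eq_of_surjOn _ t ht
  refine ⟨u.image P.subtype, ?_, ?_, ?_⟩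
  · rw [Finset.coe_image, Set.image_subset_iff]
    exact hu
  · calc (u.image P.subtype).card ≤ u.card := Finset.card_image_le
      _ = (u.image q).card := (Finset.card_image_of_injOn hinj).symm
      _ = Module.finrank (R ⧸ maximalIdeal R) W := ht_card
      _ < Module.finrank (R ⧸ maximalIdeal R) V := finrank_lt hW_ne
      _ = P.spanFinrank := (spanFinrank_eq_finrank_quotient P hP).symm
  · have hle : N' ≤ span R (u : Set P) ⊔ maximalIdeal R • ⊤ := by
      rw [sup_comm, ← comap_map_mkQ, ← map_le_iff_le_comap]
      change N'.map q ≤ (span R (u : Set P)).map q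
      rw [← hW, map_span, ← restrictScalars_span R (R ⧸ maximalIdeal R)
        Ideal.Quotient.mk_surjective, ← Finset.coe_image, ht_span]
    have := map_mono (f := P.subtype) hle
    rwa [Submodule.map_sup, map_smul'', map_span, Submodule.map_top, range_subtype, map_comap_subtype,
      inf_eq_right.mpr hNP.le, ← Finset.coe_image] at this

/-- An ideal of a Noetherian local ring generated by finitely many elements and lying between a
power of the maximal ideal and the maximal ideal needs at least `dim R` generators. -/
theorem ringKrullDim_le_card_of_pow_maximalIdeal_le_span {R : Type*} [CommRing R] [IsLocalRing R]
    [IsNoetherianRing R] {s : Finset R} (hs : Ideal.span (s : Set R) ≤ maximalIdeal R) {n : ℕ}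
    (hn : maximalIdeal R ^ n ≤ Ideal.span (s : Set R)) :
    ringKrullDim R ≤ (s.card : WithBot ℕ∞) := by
  rw [← maximalIdeal_height_eq_ringKrullDim]
  have : maximalIdeal R ∈ (Ideal.span (s : Set R)).minimalPrimes :=
    ⟨⟨inferInstance, hs⟩, fun p hp _ ↦ hp.1.le_of_pow_le (hn.trans hp.2)⟩
  exact_mod_cast Ideal.height_le_card_of_mem_minimalPrimes_span_finset this

/-- A subideal which agrees with a reduction of `I` up to `𝔪 I` is itself a reduction of `I`. -/
theorem IsIdealReduction.of_le_sup_smul {R : Type*} [CommRing R] [IsLocalRing R]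
    [IsNoetherianRing R] {I J K : Ideal R} (hJ : IsIdealReduction J I) (hKI : K ≤ I)
    (hJK : J ≤ K ⊔ maximalIdeal R • I) : IsIdealReduction K I := by
  obtain ⟨-, n, hn⟩ := hJ
  refine ⟨hKI, n, le_antisymm ?_ ?_⟩
  · rw [pow_succ']
    exact Ideal.mul_mono_left hKI
  · refine Submodule.le_of_le_smul_of_le_jacobson_bot (I := maximalIdeal R)
      (IsNoetherian.noetherian _) (by rw [jacobson_eq_maximalIdeal _ bot_ne_top]) ?_
    calc I ^ (n + 1) = J * I ^ n := hn.symm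
      _ ≤ (K ⊔ maximalIdeal R • I) * I ^ n := Ideal.mul_mono_left hJK
      _ = K * I ^ n ⊔ maximalIdeal R • I ^ (n + 1) := by
        rw [Ideal.sup_mul, smul_eq_mul, smul_eq_mul, mul_assoc, ← pow_succ']

/-- In a Noetherian local ring with infinite residue field, an ideal generated by a system of
parameters has no proper reduction. -/
theorem parameter_ideal_no_proper_reduction
    (R : Type*) [CommRing R] [IsLocalRing R] [IsNoetherianRing R]
    (hres : Infinite (ResidueField R))
    {d : ℕ} (x : Fin d → R) (hx : IsSystemOfParameters R x)
    (I : Ideal R) (hI : I = Ideal.span (Set.range x))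
    (J : Ideal R) (hJI : J ≤ I) (hred : IsIdealReduction J I) :
    J = I := by
  by_contra hne
  obtain ⟨hdim, hxm, n, hn⟩ := hx
  rw [← hI] at hn
  have hIm : I ≤ maximalIdeal R := by
    rw [hI, Ideal.span_le]
    rintro _ ⟨i, rfl⟩
    exact hxm i
  obtain ⟨s, hsJ, hcard, hJs⟩ :=
    exists_finset_card_lt_spanFinrank_of_lt I.fg_of_isNoetherianRing (lt_of_le_of_ne hJI hne)
  have hsI : Ideal.span (s : Set R) ≤ I := (Ideal.span_le.mpr hsJ).trans hJI
  obtain ⟨-, r, hr⟩ := hred.of_le_sup_smul hsI hJs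
  have hpow : maximalIdeal R ^ (n * (r + 1)) ≤ Ideal.span (s : Set R) :=
    calc maximalIdeal R ^ (n * (r + 1)) = (maximalIdeal R ^ n) ^ (r + 1) := pow_mul ..
      _ ≤ I ^ (r + 1) := Ideal.pow_right_mono hn _
      _ ≤ Ideal.span (s : Set R) := hr ▸ Ideal.mul_le_left
  have hle := ringKrullDim_le_card_of_pow_maximalIdeal_le_span (hsI.trans hIm) hpow
  have hrank : I.spanFinrank ≤ d := by
    rw [hI]
    refine (Submodule.spanFinrank_span_le_ncard_of_finite (Set.finite_range x)).trans ?_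
    rw [← Set.image_univ]
    simpa using Set.ncard_image_le (f := x) Set.finite_univ
  rw [hdim] at hle
  have : d ≤ s.card := by exact_mod_cast hle
  omega
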